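/- Let φ be a minimal homeomorphism of a Cantor set X and σ an involutive homeomorphism of X with σ∘φ∘σ = φ⁻¹, giving an action α of ℤ⋊ℤ₂ via α_{(n,i)} = φⁿ∘σ^i. Suppose α is not free. Then the transfer map tr : C(X,ℤ)/N → C(X,ℤ)/B, [f] ↦ [f + f∘σ], is injective; equivalently, if f + f∘σ = h − h∘φ for some h ∈ C(X,ℤ), then f ∈ N. Hence tr is an isomorphism of C(X,ℤ)/N onto the subgroup (1+σ_*)(C(X,ℤ)/B) = {[f + f∘σ] : f ∈ C(X,ℤ)}. -/

import Mathlib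

variable {X : Type*} [TopologicalSpace X]

/-- The subgroup `B = {h - h ∘ ψ : h ∈ C(Z, ℤ)}` of `C(Z, ℤ)`. -/
def coboundariesSubgroup {Z : Type*} [TopologicalSpace Z] (ψ : C(Z, Z)) :
    AddSubgroup C(Z, ℤ) :=
  (AddMonoidHom.mk' (fun h : C(Z, ℤ) => h - h.comp ψ)
    (fun f g => by ext x; simp; ring)).range

/-- The subgroup `N` of `C(X, ℤ)` generated by
`{f - f ∘ φ : f ∈ C(X, ℤ)} ∪ {f - f ∘ σ : f ∈ C(X, ℤ)}`. -/
def dihedralCoboundaries (φ σ : X ≃ₜ X) : AddSubgroup C(X, ℤ) :=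
  AddSubgroup.closure
    ({f | ∃ g : C(X, ℤ), f = g - g.comp (φ : C(X, X))} ∪
      {f | ∃ g : C(X, ℤ), f = g - g.comp (σ : C(X, X))})

/-- The subgroup `(1 + σ_*) H₀(ℤ, C(X, ℤ)) = {[f + f ∘ σ] : f ∈ C(X, ℤ)}` of the
coinvariants `H₀(ℤ, C(X, ℤ)) = C(X, ℤ) ⧸ {h - h ∘ φ}`. -/
def onePlusSigmaStar (φ σ : X ≃ₜ X) :
    AddSubgroup (C(X, ℤ) ⧸ coboundariesSubgroup (φ : C(X, X))) :=
  AddSubgroup.map (QuotientAddGroup.mk' (coboundariesSubgroup (φ : C(X, X))))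
    (AddMonoidHom.mk' (fun f : C(X, ℤ) => f + f.comp (σ : C(X, X)))
      (fun f g => by ext x; simp; ring)).range

/-- A point of a nonempty perfect Hausdorff space with dense orbit under `p` is not periodic. -/
theorem zpow_apply_ne_self_of_dense {X : Type*} [TopologicalSpace X] [T2Space X]
    [PerfectSpace X] (p : Equiv.Perm X) (x : X)
    (hdense : Dense (Set.range fun n : ℤ => (p ^ n) x)) {n : ℤ} (hn : n ≠ 0) :
    (p ^ n) x ≠ x := by
  intro hx
  have hsub : (Set.range fun k : ℤ => (p ^ k) x) ⊆ (fun k : ℤ => (p ^ k) x) '' Set.Ico 0 |n| := by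
    rintro _ ⟨k, rfl⟩
    refine ⟨k % n, ⟨Int.emod_nonneg k hn, Int.emod_lt_abs k hn⟩, ?_⟩
    have hk : (p ^ k) x = (p ^ (k % n)) (((p ^ n) ^ (k / n)) x) := by
      rw [← Equiv.Perm.mul_apply, ← zpow_mul, ← zpow_add, Int.emod_add_mul_ediv]
    simp only [hk, Equiv.Perm.zpow_apply_eq_self_of_apply_eq_self hx]
  have hfin := ((Set.finite_Ico 0 |n|).image fun k : ℤ => (p ^ k) x).subset hsub
  have huniv : (Set.univ : Set X).Finite := by
    rw [← hdense.closure_eq, hfin.isClosed.closure_eq]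
    exact hfin
  have : Finite X := Set.finite_univ_iff.mp huniv
  have hbot : (nhdsWithin x {x}ᶜ).NeBot := inferInstance
  exact hbot.ne (by simp [nhdsWithin, nhds_discrete, ← Filter.principal_singleton])

/-- If `s` is an involution inverting `p` and some reflection `pⁿ s` has a fixed point, then so
does one of the two reflections `s` and `p s`. -/
theorem exists_fixed_of_reflection {X : Type*} (p s : Equiv.Perm X) (hs : s * s = 1)
    (hrel : s * p * s = p⁻¹) {n : ℤ} {x : X} (hx : (p ^ n) (s x) = x) :
    (∃ y, s y = y) ∨ ∃ y, p (s y) = y := by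
  have hs' : s⁻¹ = s := inv_eq_of_mul_eq_one_left hs
  have hconj (k : ℤ) : s * p ^ k = p ^ (-k) * s := by
    have h := conj_zpow (i := k) (a := s) (b := p)
    rw [hs', hrel, inv_zpow'] at h
    rw [h, mul_assoc, hs, mul_one]
  have hsx : s x = (p ^ (-n)) x := by
    rw [zpow_neg, Equiv.Perm.eq_inv_iff_eq, hx]
  have hmove (m : ℤ) : s ((p ^ (-m)) x) = (p ^ (m - n)) x := by
    rw [← Equiv.Perm.mul_apply, hconj, Equiv.Perm.mul_apply, hsx, ← Equiv.Perm.mul_apply,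
      ← zpow_add, neg_neg, sub_eq_add_neg]
  obtain ⟨m, rfl | rfl⟩ := Int.even_or_odd' n
  · left
    refine ⟨(p ^ (-m)) x, ?_⟩
    rw [hmove]
    congr 2
    ring
  · right
    refine ⟨(p ^ (-m)) x, ?_⟩
    rw [hmove, ← Equiv.Perm.mul_apply, ← zpow_one_add]
    congr 2
    ring

/-- An integer-valued continuous function invariant under a minimal homeomorphism is constant. -/
theorem eq_const_of_invariant {X : Type*} [TopologicalSpace X] (φ : X ≃ₜ X) (x : X)
    (hdense : Dense (Set.range fun n : ℤ => (φ.toEquiv ^ n) x)) (k : C(X, ℤ))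
    (hk : ∀ y, k (φ y) = k y) (y : X) : k y = k x := by
  have hz (n : ℤ) : k ((φ.toEquiv ^ n) x) = k x := by
    induction n using Int.induction_on with
    | zero => simp
    | succ n ih =>
      rw [add_comm, zpow_one_add, Equiv.Perm.mul_apply]
      exact (hk _).trans ih
    | pred n ih =>
      rw [← ih, ← hk, sub_eq_add_neg, add_comm, zpow_add, zpow_neg_one, Equiv.Perm.mul_apply]
      congr 1
      exact φ.apply_symm_apply _
  have heq : (k : X → ℤ) = fun _ => k x :=
    k.continuous.ext_on hdense continuous_const (by rintro _ ⟨n, rfl⟩; exact hz n)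
  exact congrFun heq y

/-- A continuous integer-valued function antisymmetric under `τ` has the form `g - g ∘ τ`. -/
theorem exists_eq_sub_comp_of_antisymm {X : Type*} [TopologicalSpace X] (τ : C(X, X))
    (u : C(X, ℤ)) (hu : ∀ x, u (τ x) = -u x) : ∃ g : C(X, ℤ), u = g - g.comp τ := by
  refine ⟨u ⊔ 0, ?_⟩
  ext x
  simp only [ContinuousMap.sub_apply, ContinuousMap.comp_apply, ContinuousMap.sup_apply,
    ContinuousMap.zero_apply, hu]
  grind

/-- The homomorphism `f ↦ [f + f ∘ σ]` inducing the transfer map. -/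
def transferHom (φ σ : X ≃ₜ X) : C(X, ℤ) →+ C(X, ℤ) ⧸ coboundariesSubgroup (φ : C(X, X)) :=
  (QuotientAddGroup.mk' (coboundariesSubgroup (φ : C(X, X)))).comp
    (AddMonoidHom.mk' (fun f : C(X, ℤ) => f + f.comp (σ : C(X, X)))
      (fun f g => by ext x; simp; ring))

theorem range_transferHom (φ σ : X ≃ₜ X) : (transferHom φ σ).range = onePlusSigmaStar φ σ :=
  AddMonoidHom.range_comp _ _

theorem mem_ker_transferHom (φ σ : X ≃ₜ X) (f : C(X, ℤ)) :
    f ∈ (transferHom φ σ).ker ↔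
      ∃ h : C(X, ℤ), f + f.comp (σ : C(X, X)) = h - h.comp (φ : C(X, X)) := by
  rw [AddMonoidHom.mem_ker]
  refine (QuotientAddGroup.eq_zero_iff _).trans ?_
  exact ⟨fun ⟨h, hh⟩ => ⟨h, hh.symm⟩, fun ⟨h, hh⟩ => ⟨h, hh.symm⟩⟩

theorem dihedralCoboundaries_le_ker_transferHom (φ σ : X ≃ₜ X) (hσ : ∀ x, σ (σ x) = x)
    (hrel : ∀ x, σ (φ (σ x)) = φ.symm x) :
    dihedralCoboundaries φ σ ≤ (transferHom φ σ).ker := by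
  refine (AddSubgroup.closure_le _).mpr ?_
  rintro _ (⟨g, rfl⟩ | ⟨g, rfl⟩)
  · refine (mem_ker_transferHom _ _ _).mpr ⟨g - (g.comp (φ : C(X, X))).comp (σ : C(X, X)), ?_⟩
    ext x
    have h : φ (σ (φ x)) = σ x := by
      rw [← hσ (φ (σ (φ x))), hrel, φ.symm_apply_apply]
    simp [h]
    ring
  · refine (mem_ker_transferHom _ _ _).mpr ⟨0, ?_⟩
    ext x
    simp [hσ]

/-- If `σ` or `φ ∘ σ` has a fixed point, a function whose transfer is a coboundary lies in `N`. -/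
theorem mem_dihedralCoboundaries_of_fixed (φ σ : X ≃ₜ X) [Nonempty X]
    (hφmin : ∀ x : X, Dense (Set.range fun n : ℤ => (φ.toEquiv ^ n) x))
    (hσ : ∀ x, σ (σ x) = x) (hrel : ∀ x, σ (φ (σ x)) = φ.symm x)
    (hfix : (∃ y, σ y = y) ∨ ∃ y, φ (σ y) = y) (f h : C(X, ℤ))
    (hfh : ∀ x, f x + f (σ x) = h x - h (φ x)) : f ∈ dihedralCoboundaries φ σ := by
  have hφσφ (x : X) : φ (σ (φ x)) = σ x := by
    rw [← hσ (φ (σ (φ x))), hrel, φ.symm_apply_apply]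
  have x₀ : X := Classical.arbitrary X
  obtain ⟨c, hc⟩ : ∃ c, ∀ x, h x + h (φ (σ x)) = c := by
    refine ⟨_, eq_const_of_invariant φ x₀ (hφmin x₀)
      (h + (h.comp (φ : C(X, X))).comp (σ : C(X, X))) fun y => ?_⟩
    have h₁ := hfh y
    have h₂ := hfh (σ y)
    rw [hσ] at h₂
    simp only [ContinuousMap.add_apply, ContinuousMap.comp_apply, ContinuousMap.coe_coe, hφσφ]
    linarith
  obtain ⟨d, rfl⟩ : ∃ d, c = 2 * d := by
    obtain ⟨y, hy⟩ | ⟨y, hy⟩ := hfix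
    · refine ⟨h y - f y, ?_⟩
      have h₁ := hfh y
      have h₂ := hc y
      rw [hy] at h₁ h₂
      linarith
    · refine ⟨h y, ?_⟩
      have h₂ := hc y
      rw [hy] at h₂
      linarith
  set k : C(X, ℤ) := h - ContinuousMap.const X d with hk
  have hkx (x : X) : k x = h x - d := rfl
  obtain ⟨a, ha⟩ := exists_eq_sub_comp_of_antisymm (σ : C(X, X)) (f - k) fun x => by
    have h₁ := hfh x
    have h₂ := hc (σ x)
    rw [hσ] at h₂
    simp only [ContinuousMap.sub_apply, ContinuousMap.coe_coe, hkx]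
    linarith
  obtain ⟨b, hb⟩ := exists_eq_sub_comp_of_antisymm ((φ : C(X, X)).comp (σ : C(X, X))) k fun x => by
    have h₂ := hc x
    simp only [ContinuousMap.comp_apply, ContinuousMap.coe_coe, hkx]
    linarith
  have hφN (g : C(X, ℤ)) : g - g.comp (φ : C(X, X)) ∈ dihedralCoboundaries φ σ :=
    AddSubgroup.subset_closure (Or.inl ⟨g, rfl⟩)
  have hσN (g : C(X, ℤ)) : g - g.comp (σ : C(X, X)) ∈ dihedralCoboundaries φ σ :=
    AddSubgroup.subset_closure (Or.inr ⟨g, rfl⟩)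
  have hkN : k ∈ dihedralCoboundaries φ σ := by
    rw [hb, ← ContinuousMap.comp_assoc, ← sub_add_sub_cancel b (b.comp (φ : C(X, X)))]
    exact add_mem (hφN b) (hσN _)
  rw [← sub_add_cancel f k]
  exact add_mem (ha ▸ hσN a) hkN

/-- Let `φ` be a minimal homeomorphism of a Cantor set `X` and `σ` an involutive
homeomorphism with `σφσ = φ⁻¹`.  If the associated `ℤ ⋊ ℤ₂`-action is not free, then the
transfer map `tr : C(X, ℤ)/N → C(X, ℤ)/B`, `[f] ↦ [f + f ∘ σ]`, is injective: if
`f + f ∘ σ = h - h ∘ φ` then `f ∈ N`.  Hence `tr` is an isomorphism of `C(X, ℤ)/N` onto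
`(1 + σ_*)(C(X, ℤ)/B)`. -/
theorem transfer_injective_of_not_free {X : Type*} [TopologicalSpace X] [CompactSpace X]
    [TopologicalSpace.MetrizableSpace X] [TotallyDisconnectedSpace X] [PerfectSpace X]
    [Nonempty X] (φ σ : X ≃ₜ X)
    (hφmin : ∀ x : X, Dense (Set.range fun n : ℤ => (φ.toEquiv ^ n) x))
    (hσ : ∀ x, σ (σ x) = x) (hrel : ∀ x, σ (φ (σ x)) = φ.symm x)
    (hnotfree : ∃ (n : ℤ) (i : Bool) (x : X),
      (φ.toEquiv ^ n) (cond i (σ x) x) = x ∧ ¬(n = 0 ∧ i = false)) :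
    (∀ f h : C(X, ℤ),
      f + f.comp (σ : C(X, X)) = h - h.comp (φ : C(X, X)) → f ∈ dihedralCoboundaries φ σ) ∧
    Nonempty ((C(X, ℤ) ⧸ dihedralCoboundaries φ σ) ≃+ onePlusSigmaStar φ σ) := by
  have hfix : (∃ y, σ y = y) ∨ ∃ y, φ (σ y) = y := by
    obtain ⟨n, _ | _, x, hx, hni⟩ := hnotfree
    · exact absurd hx (zpow_apply_ne_self_of_dense φ.toEquiv x (hφmin x) fun hn => hni ⟨hn, rfl⟩)
    · exact exists_fixed_of_reflection φ.toEquiv σ.toEquiv (Equiv.ext hσ) (Equiv.ext hrel) hx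
  have hinj (f h : C(X, ℤ)) (hfh : f + f.comp (σ : C(X, X)) = h - h.comp (φ : C(X, X))) :
      f ∈ dihedralCoboundaries φ σ :=
    mem_dihedralCoboundaries_of_fixed φ σ hφmin hσ hrel hfix f h fun x => DFunLike.congr_fun hfh x
  have hker : dihedralCoboundaries φ σ = (transferHom φ σ).ker :=
    le_antisymm (dihedralCoboundaries_le_ker_transferHom φ σ hσ hrel) fun f hf =>
      let ⟨h, hfh⟩ := (mem_ker_transferHom φ σ f).mp hf
      hinj f h hfh
  exact ⟨hinj, ⟨(QuotientAddGroup.quotientAddEquivOfEq hker).trans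
    ((QuotientAddGroup.quotientKerEquivRange _).trans
      (AddEquiv.addSubgroupCongr (range_transferHom φ σ)))⟩⟩
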